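/- Let N ≥ 1, T ≥ 1, and let w : Fin N → ℝ be non-negative and non-increasing with w_max = max_i w i. For each round t ∈ Fin T, let U_t : Fin N → ℝ be the cumulative-utility vector at round t, let f_t : Fin N → ℝ be the true utilities with f_t n ≥ 0 for all n, and let f̂_t, h_t : Fin N → ℝ satisfy |f̂_t n − f_t n| ≤ h_t n for all n. Suppose that in each round t the index n_t maximizes n ↦ G_w(update U_t n (U_t n + f̂_t n + h_t n)) and n⋆_t maximizes n ↦ G_w(update U_t n (U_t n + f_t n)). Then the cumulative regret satisfies ∑_{t=0}^{T−1} [ G_w(update U_t n⋆_t (U_t n⋆_t + f_t n⋆_t)) − G_w(update U_t n_t (U_t n_t + f_t n_t)) ] ≤ 2 · w_max · √T · √( ∑_{t=0}^{T−1} ( h_t n_t )² ). -/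

import Mathlib

open Finset Matrix

/-- The weighted Gini social-evaluation function: `G_w(U) = ∑ i, w i * Φ_i(U)`,
where `Φ_i(U)` is the `(i+1)`-th smallest entry of `U`. -/
noncomputable def gini {N : ℕ} (w U : Fin N → ℝ) : ℝ :=
  ∑ i, w i * U (Tuple.sort U i)

/-- The sorted arrangement minimizes `∑ i, w i * U (σ i)` over permutations `σ`. -/
theorem gini_le_sum_perm {N : ℕ} {w : Fin N → ℝ} (hw : Antitone w) (U : Fin N → ℝ)
    (σ : Equiv.Perm (Fin N)) : gini w U ≤ ∑ i, w i * U (σ i) := by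
  have hanti : Antivary w (U ∘ Tuple.sort U) :=
    hw.antivary (Tuple.monotone_sort U)
  simpa [gini] using hanti.sum_mul_le_sum_mul_comp_perm (σ := σ.trans (Tuple.sort U).symm)

theorem gini_mono {N : ℕ} {w : Fin N → ℝ} (hw0 : ∀ i, 0 ≤ w i) (hw : Antitone w) :
    Monotone (gini w) := fun _ V hUV =>
  (gini_le_sum_perm hw _ (Tuple.sort V)).trans <|
    Finset.sum_le_sum fun i _ => mul_le_mul_of_nonneg_left (hUV _) (hw0 i)

theorem gini_update_le_add {N : ℕ} {w : Fin N → ℝ} (hw : Antitone w) {c : ℝ}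
    (hc : ∀ i, w i ≤ c) (U : Fin N → ℝ) (n : Fin N) {a b : ℝ} (hab : a ≤ b) :
    gini w (Function.update U n b) ≤ gini w (Function.update U n a) + c * (b - a) := by
  set σ := Tuple.sort (Function.update U n a)
  refine (gini_le_sum_perm hw _ σ).trans ?_
  have key : ∀ i, w i * Function.update U n b (σ i) =
      w i * Function.update U n a (σ i) + if i = σ.symm n then w i * (b - a) else 0 := by
    intro i
    by_cases h : σ i = n
    · have h' : i = σ.symm n := by simp [← h]
      rw [if_pos h', h, Function.update_self, Function.update_self]
      ring
    · have h' : i ≠ σ.symm n := fun e => h (by simp [e])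
      rw [if_neg h', Function.update_of_ne h, Function.update_of_ne h, add_zero]
  rw [Finset.sum_congr rfl fun i _ => key i, Finset.sum_add_distrib, Finset.sum_ite_eq',
    if_pos (Finset.mem_univ _), gini]
  gcongr
  exact hc _

theorem stmt_4 (N T : ℕ) (hN : 1 ≤ N) (hT : 1 ≤ T) (w : Fin N → ℝ)
    (hw_nonneg : ∀ i, 0 ≤ w i) (hw_anti : Antitone w)
    (wmax : ℝ) (hwmax : wmax = Finset.univ.sup' ⟨⟨0, hN⟩, Finset.mem_univ _⟩ w)
    (U f fhat h : Fin T → Fin N → ℝ)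
    (hf : ∀ t n, 0 ≤ f t n)
    (hest : ∀ t n, |fhat t n - f t n| ≤ h t n)
    (nt nstar : Fin T → Fin N)
    (hnt : ∀ t n, gini w (Function.update (U t) n (U t n + fhat t n + h t n)) ≤
      gini w (Function.update (U t) (nt t) (U t (nt t) + fhat t (nt t) + h t (nt t))))
    (hstar : ∀ t n, gini w (Function.update (U t) n (U t n + f t n)) ≤
      gini w (Function.update (U t) (nstar t) (U t (nstar t) + f t (nstar t)))) :
    ∑ t, (gini w (Function.update (U t) (nstar t) (U t (nstar t) + f t (nstar t))) -
        gini w (Function.update (U t) (nt t) (U t (nt t) + f t (nt t)))) ≤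
      2 * wmax * Real.sqrt T * Real.sqrt (∑ t, (h t (nt t)) ^ 2) := by
  have hw_le : ∀ i, w i ≤ wmax := fun i => hwmax ▸ Finset.le_sup' w (Finset.mem_univ i)
  have hmax_nonneg : 0 ≤ wmax := (hw_nonneg ⟨0, hN⟩).trans (hw_le _)
  have hround : ∀ t, gini w (Function.update (U t) (nstar t) (U t (nstar t) + f t (nstar t))) -
      gini w (Function.update (U t) (nt t) (U t (nt t) + f t (nt t))) ≤
      2 * wmax * h t (nt t) := by
    intro t
    have hs := abs_le.1 (hest t (nstar t))
    have hn := abs_le.1 (hest t (nt t))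
    have hopt : gini w (Function.update (U t) (nstar t) (U t (nstar t) + f t (nstar t))) ≤
        gini w (Function.update (U t) (nstar t)
          (U t (nstar t) + fhat t (nstar t) + h t (nstar t))) :=
      gini_mono hw_nonneg hw_anti (update_le_update_iff.2 ⟨by linarith, fun _ _ => le_rfl⟩)
    have hlip := gini_update_le_add hw_anti hw_le (U t) (nt t)
      (a := U t (nt t) + f t (nt t)) (b := U t (nt t) + fhat t (nt t) + h t (nt t)) (by linarith)
    have hwidth : wmax * (U t (nt t) + fhat t (nt t) + h t (nt t) - (U t (nt t) + f t (nt t))) ≤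
        wmax * (2 * h t (nt t)) := mul_le_mul_of_nonneg_left (by linarith) hmax_nonneg
    linarith [hnt t (nstar t)]
  have hcs : ∑ t, h t (nt t) ≤ √T * √(∑ t, h t (nt t) ^ 2) := by
    simpa using Real.sum_mul_le_sqrt_mul_sqrt Finset.univ (fun _ => 1) fun t => h t (nt t)
  calc _ ≤ ∑ t, 2 * wmax * h t (nt t) := Finset.sum_le_sum fun t _ => hround t
    _ = 2 * wmax * ∑ t, h t (nt t) := (Finset.mul_sum ..).symm
    _ ≤ 2 * wmax * (√T * √(∑ t, h t (nt t) ^ 2)) := by gcongr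
    _ = _ := by ring
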